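/- If the pair predictor p̂₂ is pair-calibrated with some grouping function Φ, then for every x ∈ 𝒳 and y ∈ 𝒴 the cheat-corrected epistemic confidence satisfies 0 ≤ C(y|x) ≤ 1. -/

import Mathlib

open Finset

open scoped Classical

/-- Conditional expectation of `f(X)` given `X ∈ [x]_Φ`, where `X ∼ μ` on a finite set. -/
noncomputable def groupExp {𝒳 𝒵 : Type*} [Fintype 𝒳] (μ : 𝒳 → ℝ) (Φ : 𝒳 → 𝒵)
    (f : 𝒳 → ℝ) (x : 𝒳) : ℝ :=
  (∑ x' : 𝒳, if Φ x' = Φ x then μ x' * f x' else 0) /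
  (∑ x' : 𝒳, if Φ x' = Φ x then μ x' else 0)

/-- Marginal `p̂₁(y|x) = ∑_{y'} p̂₂(y,y'|x)` of a pair predictor. -/
noncomputable def marginal {𝒳 𝒴 : Type*} [Fintype 𝒴] (p2 : 𝒳 → 𝒴 → 𝒴 → ℝ) (x : 𝒳) (y : 𝒴) : ℝ :=
  ∑ y' : 𝒴, p2 x y y'

/-- Cheat-corrected epistemic variance `V̂(y|x) = p̂₂(y,y|x) − p̂₁(y|x)²`. -/
noncomputable def cheatVar {𝒳 𝒴 : Type*} [Fintype 𝒴] (p2 : 𝒳 → 𝒴 → 𝒴 → ℝ) (x : 𝒳) (y : 𝒴) : ℝ :=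
  p2 x y y - (marginal p2 x y) ^ 2

/-- Cheat-corrected epistemic confidence `C(y|x)`. -/
noncomputable def cheatConf {𝒳 𝒴 : Type*} [Fintype 𝒴] (p2 : 𝒳 → 𝒴 → 𝒴 → ℝ) (x : 𝒳) (y : 𝒴) : ℝ :=
  if 0 < p2 x y y then (marginal p2 x y) ^ 2 / p2 x y y else 0


theorem groupExp_sum {𝒳 𝒵 ι : Type*} [Fintype 𝒳] (μ : 𝒳 → ℝ) (Φ : 𝒳 → 𝒵)
    (s : Finset ι) (f : ι → 𝒳 → ℝ) (x : 𝒳) :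
    groupExp μ Φ (fun x' => ∑ i ∈ s, f i x') x = ∑ i ∈ s, groupExp μ Φ (f i) x := by
  simp only [groupExp, ← Finset.sum_div, ← Finset.sum_filter, Finset.mul_sum]
  rw [Finset.sum_comm]

theorem sq_groupExp_le {𝒳 𝒵 : Type*} [Fintype 𝒳] {μ : 𝒳 → ℝ} (hμ : ∀ x, 0 ≤ μ x)
    (Φ : 𝒳 → 𝒵) (f : 𝒳 → ℝ) (x : 𝒳) :
    groupExp μ Φ f x ^ 2 ≤ groupExp μ Φ (fun x' => f x' * f x') x := by
  simp only [groupExp, ← Finset.sum_filter]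
  set s := Finset.univ.filter fun x' => Φ x' = Φ x
  have hcs : (∑ i ∈ s, μ i * f i) ^ 2 ≤ (∑ i ∈ s, μ i * (f i * f i)) * ∑ i ∈ s, μ i :=
    Finset.sum_sq_le_sum_mul_sum_of_sq_le_mul s
      (fun i _ => mul_nonneg (hμ i) (mul_self_nonneg _)) (fun i _ => hμ i)
      (fun i _ => le_of_eq (by ring))
  rcases (Finset.sum_nonneg fun i _ => hμ i : 0 ≤ ∑ i ∈ s, μ i).eq_or_lt with h | h
  · simp [← h]
  · rw [div_pow, div_le_div_iff₀ (by positivity) h]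
    calc _ ≤ ((∑ i ∈ s, μ i * (f i * f i)) * ∑ i ∈ s, μ i) * ∑ i ∈ s, μ i := by gcongr
      _ = _ := by ring

theorem marginal_eq_groupExp {𝒳 𝒴 𝒵 : Type*} [Fintype 𝒳] [Fintype 𝒴] {μ : 𝒳 → ℝ}
    {p : 𝒳 → 𝒴 → ℝ} (hp : ∀ x, ∑ y, p x y = 1) {p2 : 𝒳 → 𝒴 → 𝒴 → ℝ} {Φ : 𝒳 → 𝒵}
    (hcal : ∀ x y₁ y₂, p2 x y₁ y₂ = groupExp μ Φ (fun x' => p x' y₁ * p x' y₂) x)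
    (x : 𝒳) (y : 𝒴) : marginal p2 x y = groupExp μ Φ (fun x' => p x' y) x := by
  simp only [marginal, hcal, ← groupExp_sum, ← Finset.mul_sum, hp, mul_one]

/-- The cheat-corrected epistemic confidence of a pair-calibrated pair
predictor lies in `[0, 1]`. -/
theorem stmt_9 {𝒳 𝒴 𝒵 : Type*} [Fintype 𝒳] [Fintype 𝒴] [Nonempty 𝒳] [Nonempty 𝒴]
    (μ : 𝒳 → ℝ) (hμpos : ∀ x, 0 < μ x) (hμsum : ∑ x, μ x = 1)
    (p : 𝒳 → 𝒴 → ℝ) (hp0 : ∀ x y, 0 ≤ p x y) (hp1 : ∀ x, ∑ y, p x y = 1)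
    (p2 : 𝒳 → 𝒴 → 𝒴 → ℝ)
    (hp20 : ∀ x y₁ y₂, 0 ≤ p2 x y₁ y₂) (hp21 : ∀ x, ∑ y₁, ∑ y₂, p2 x y₁ y₂ = 1)
    (Φ : 𝒳 → 𝒵)
    (hcal : ∀ x y₁ y₂, p2 x y₁ y₂ = groupExp μ Φ (fun x' => p x' y₁ * p x' y₂) x) :
    ∀ x y, 0 ≤ cheatConf p2 x y ∧ cheatConf p2 x y ≤ 1 := by
  intro x y
  unfold cheatConf
  split_ifs with h
  · refine ⟨by positivity, (div_le_one h).2 ?_⟩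
    rw [marginal_eq_groupExp hp1 hcal, hcal]
    exact sq_groupExp_le (fun x => (hμpos x).le) Φ _ x
  · exact ⟨le_rfl, zero_le_one⟩
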